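/- For any constants λ > 1 and C > 0 with λ < e^C (so that λe^{−C} < 1), there exists a smooth monotone increasing function G : (0,∞) → (0,∞) such that G(t) = t in a neighborhood of t = λ, G(t) = 1 for t ≤ λe^{−C}, and t·(log G)'(t) = t·G'(t)/G(t) ≤ 1 for all t > 0. -/

import Mathlib

noncomputable section

lemma smoothTransition_symm (x : ℝ) :
    Real.smoothTransition x + Real.smoothTransition (1 - x) = 1 := by
  have hp := Real.smoothTransition.pos_denom x
  unfold Real.smoothTransition
  rw [sub_sub_cancel, add_comm (expNegInvGlue (1 - x)) (expNegInvGlue x), ← add_div,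
    div_self hp.ne']

lemma exists_h (d : ℝ) (hd : 0 < d) : ∃ h φ : ℝ → ℝ, (∀ s, HasDerivAt h (φ s) s) ∧
    ContDiff ℝ (⊤ : ℕ∞) h ∧ (∀ s, 0 ≤ φ s) ∧ (∀ s, φ s ≤ 1) ∧
    (∀ s, s ≤ -d → h s = 0) ∧ (∀ s, d ≤ s → h s = s) := by
  set φ : ℝ → ℝ := fun s => Real.smoothTransition ((s + d) / (2 * d)) with hφ
  have hsm : ContDiff ℝ (⊤ : ℕ∞) φ :=
    Real.smoothTransition.contDiff.comp (by fun_prop)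
  have hc : Continuous φ := hsm.continuous
  have hi : ∀ a b, IntervalIntegrable φ MeasureTheory.volume a b :=
    fun a b => hc.intervalIntegrable a b
  have hder : ∀ s, HasDerivAt (fun s => ∫ x in (-d)..s, φ x) (φ s) s := fun s =>
    intervalIntegral.integral_hasDerivAt_right (hi _ _)
      hc.aestronglyMeasurable.stronglyMeasurableAtFilter hc.continuousAt
  have hsymm : ∀ s, φ s + φ (-s) = 1 := by
    intro s
    have := smoothTransition_symm ((s + d) / (2 * d))
    have e : 1 - (s + d) / (2 * d) = (-s + d) / (2 * d) := by field_simp; ring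
    rw [e] at this
    exact this
  have hmid : ∫ x in (-d)..d, φ x = d := by
    have h1 : ∫ x in (-d)..d, φ (-x) = ∫ x in (-d)..d, φ x := by
      rw [intervalIntegral.integral_comp_neg]; simp
    have h2 : ∫ x in (-d)..d, (φ x + φ (-x)) = 2 * d := by
      simp only [hsymm]; simp; ring
    have hn : IntervalIntegrable (fun x => φ (-x)) MeasureTheory.volume (-d) d :=
      (hc.comp continuous_neg).intervalIntegrable _ _
    rw [intervalIntegral.integral_add (hi _ _) hn, h1] at h2
    linarith
  refine ⟨fun s => ∫ x in (-d)..s, φ x, φ, hder, ?_, fun s => Real.smoothTransition.nonneg _,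
    fun s => Real.smoothTransition.le_one _, ?_, ?_⟩
  · rw [contDiff_infty_iff_deriv]
    refine ⟨fun s => (hder s).differentiableAt, ?_⟩
    rw [show deriv (fun s => ∫ x in (-d)..s, φ x) = φ from funext fun s => (hder s).deriv]
    exact hsm
  · intro s hs
    have : ∫ x in (-d)..s, φ x = ∫ x in (-d)..s, (0 : ℝ) := by
      apply intervalIntegral.integral_congr
      intro x hx
      rw [Set.uIcc_of_ge hs] at hx
      exact Real.smoothTransition.zero_of_nonpos
        (div_nonpos_of_nonpos_of_nonneg (by linarith [hx.2]) (by linarith))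
    simpa using this
  · intro s hs
    have : ∫ x in d..s, φ x = ∫ x in d..s, (1 : ℝ) := by
      apply intervalIntegral.integral_congr
      intro x hx
      rw [Set.uIcc_of_le hs] at hx
      exact Real.smoothTransition.one_of_one_le
        ((one_le_div (by linarith)).2 (by linarith [hx.1]))
    have h3 := intervalIntegral.integral_add_adjacent_intervals (hi (-d) d) (hi d s)
    rw [hmid, this] at h3
    simp at h3
    exact h3.symm

/-- For constants `λ > 1` with `λ < e^C` (so `λe^{−C} < 1`), there is a smooth
monotone increasing `G : (0,∞) → (0,∞)` with `G(t) = t` near `t = λ`,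
`G(t) = 1` for `t ≤ λe^{−C}`, and `t·G'(t)/G(t) ≤ 1` for all `t > 0`. -/
theorem exists_G (lam C : ℝ) (hlam : 1 < lam) (hC : lam < Real.exp C) :
    ∃ G : ℝ → ℝ,
      ContDiffOn ℝ (⊤ : ℕ∞) G (Set.Ioi 0) ∧
      (∀ t, 0 < t → 0 < G t) ∧
      MonotoneOn G (Set.Ioi 0) ∧
      (∃ ε > 0, ∀ t, |t - lam| < ε → G t = t) ∧
      (∀ t, 0 < t → t ≤ lam * Real.exp (-C) → G t = 1) ∧
      (∀ t, 0 < t → t * deriv G t / G t ≤ 1) := by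
  have hb : 0 < Real.log lam := Real.log_pos hlam
  have ha : Real.log lam < C := (Real.log_lt_iff_lt_exp (by linarith)).2 hC
  obtain ⟨d, hd, hda, hdb⟩ : ∃ d : ℝ, 0 < d ∧ d < C - Real.log lam ∧ d < Real.log lam := by
    obtain ⟨d, h1, h2⟩ := exists_between (lt_min (sub_pos.2 ha) hb)
    exact ⟨d, h1, lt_min_iff.1 h2⟩
  obtain ⟨h, φ, hder, hsm, h0, h1, hz, hs⟩ := exists_h d hd
  have hdG : ∀ t, 0 < t → HasDerivAt (fun t => Real.exp (h (Real.log t)))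
      (Real.exp (h (Real.log t)) * (φ (Real.log t) * t⁻¹)) t := fun t ht =>
    ((hder (Real.log t)).comp t (Real.hasDerivAt_log ht.ne')).exp
  have hmono : Monotone h := monotone_of_deriv_nonneg
    (fun s => (hder s).differentiableAt) (fun s => by rw [(hder s).deriv]; exact h0 s)
  refine ⟨fun t => Real.exp (h (Real.log t)), ?_, fun t _ => Real.exp_pos _, ?_, ?_, ?_, ?_⟩
  · have hl : ContDiffOn ℝ (⊤ : ℕ∞) Real.log (Set.Ioi 0) :=
      Real.contDiffOn_log.mono (fun x hx => ne_of_gt hx)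
    exact (Real.contDiff_exp.comp hsm).comp_contDiffOn hl
  · intro x hx y hy hxy
    exact Real.exp_le_exp.2 (hmono (Real.log_le_log hx hxy))
  · have hlt : Real.exp d < lam := (Real.lt_log_iff_exp_lt (by linarith)).1 hdb
    refine ⟨lam - Real.exp d, by linarith, fun t ht => ?_⟩
    have ht1 : Real.exp d < t := by linarith [(abs_lt.1 ht).1]
    have ht0 : 0 < t := (Real.exp_pos d).trans ht1
    simp only
    rw [hs _ ((Real.lt_log_iff_exp_lt ht0).2 ht1).le, Real.exp_log ht0]
  · intro t ht htl
    have := Real.log_le_log ht htl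
    rw [Real.log_mul (by linarith) (Real.exp_pos _).ne', Real.log_exp] at this
    simp only
    rw [hz _ (by linarith), Real.exp_zero]
  · intro t ht
    rw [(hdG t ht).deriv]
    have e : t * (Real.exp (h (Real.log t)) * (φ (Real.log t) * t⁻¹)) / Real.exp (h (Real.log t))
      = φ (Real.log t) := by
      have := (Real.exp_pos (h (Real.log t))).ne'
      field_simp
    simp only
    rw [e]
    exact h1 _
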